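/- There is a constant c such that the following holds. For every bottom-up deterministic tree automaton A' on the alphabet Σ̄ = {enu, upd, fix} × {0,1}, and every Σ-tree T (with Σ = {enu, upd, fix}) in which all internal nodes are labeled fix, there exists a hybrid circuit C that is a provenance circuit of A' on T, is a d-DNNF, is upwards-deterministic, has at most c · |T| · |A'| gates, has maximal fan-in at most c · |A'|, and has dependency size Δ(C) at most c · |A'| · h(T), where |T| is the number of nodes of T and h(T) its height. -/

import Mathlib

namespace MSOEnum

inductive GateType : Type
  | svar | bvar | union | prod | box | band | bor | bnot
  deriving DecidableEq

def GateType.isBoolean : GateType → Prop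
  | .bvar => True
  | .band => True
  | .bor => True
  | .bnot => True
  | _ => False

/-- A hybrid circuit: a finite DAG of gates, where `wire g g'` means that `g`
is an input of `g'`, with an output gate and gate types satisfying the
structural requirements of hybrid circuits. -/
structure HybridCircuit (α : Type) where
  gates : Finset α
  wire : α → α → Prop
  wire_mem : ∀ a b, wire a b → a ∈ gates ∧ b ∈ gates
  acyclic : WellFounded wire
  τ : α → GateType
  out : α
  out_mem : out ∈ gates
  out_setValued : ¬ (τ out).isBoolean
  var_no_input : ∀ g, (τ g = GateType.svar ∨ τ g = GateType.bvar) → ∀ g', ¬ wire g' g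
  boolGate_inputs : ∀ g, (τ g = GateType.band ∨ τ g = GateType.bor ∨ τ g = GateType.bnot) →
    ∀ g', wire g' g → (τ g').isBoolean
  bnot_input : ∀ g ∈ gates, τ g = GateType.bnot → ∃! g', wire g' g
  setGate_inputs : ∀ g, (τ g = GateType.union ∨ τ g = GateType.prod) →
    ∀ g', wire g' g → ¬ (τ g').isBoolean
  prod_inputs : ∀ g ∈ gates, τ g = GateType.prod →
    (∀ g', ¬ wire g' g) ∨
    ∃ g₁ g₂, g₁ ≠ g₂ ∧ wire g₁ g ∧ wire g₂ g ∧ ∀ g', wire g' g → g' = g₁ ∨ g' = g₂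
  box_inputs : ∀ g ∈ gates, τ g = GateType.box →
    ∃ gs gb, ¬ (τ gs).isBoolean ∧ (τ gb).isBoolean ∧ wire gs g ∧ wire gb g ∧
      ∀ g', wire g' g → g' = gs ∨ g' = gb

variable {α : Type}

open Classical in
/-- The Boolean value `⟨g⟩_ν` captured by each (Boolean) gate, computed bottom-up. -/
noncomputable def bval (C : HybridCircuit α) (ν : α → Bool) : α → Bool :=
  C.acyclic.fix fun g rec =>
    match C.τ g with
    | .bvar => ν g
    | .band => decide (∀ g' (h : C.wire g' g), rec g' h = true)
    | .bor => decide (∃ g', ∃ h : C.wire g' g, rec g' h = true)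
    | .bnot => decide (∀ g' (h : C.wire g' g), rec g' h = false)
    | _ => false

open Classical in
/-- The set `⟦g⟧_ν` of assignments captured by each (set-valued) gate, computed bottom-up. -/
noncomputable def sval (C : HybridCircuit α) (ν : α → Bool) : α → Set (Set α) :=
  C.acyclic.fix fun g rec =>
    match C.τ g with
    | .svar => {{g}}
    | .union => {a | ∃ g', ∃ h : C.wire g' g, a ∈ rec g' h}
    | .prod =>
        if ∀ g', ¬ C.wire g' g then {∅}
        else {a | ∃ g₁ g₂, ∃ (h₁ : C.wire g₁ g) (h₂ : C.wire g₂ g), g₁ ≠ g₂ ∧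
          ∃ a₁ ∈ rec g₁ h₁, ∃ a₂ ∈ rec g₂ h₂, a = a₁ ∪ a₂}
    | .box => {a | (∃ g', ∃ h : C.wire g' g, ¬ (C.τ g').isBoolean ∧ a ∈ rec g' h) ∧
        ∀ g'', C.wire g'' g → (C.τ g'').isBoolean → bval C ν g'' = true}
    | _ => (∅ : Set (Set α))

open Classical in
/-- The partial evaluation `ω_ν`. -/
noncomputable def omegaEval (C : HybridCircuit α) (ν : α → Bool) (g : α) : Bool :=
  if (C.τ g).isBoolean then bval C ν g else decide (sval C ν g).Nonempty

def boxStep (C : HybridCircuit α) (a b : α) : Prop := C.wire a b ∧ C.τ b = GateType.box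

/-- A ⊠-path from `g'` to `g` that is live under `ν`. -/
def liveBoxPath (C : HybridCircuit α) (ν : α → Bool) (g' g : α) : Prop :=
  ∃ g'', Relation.ReflTransGen (boxStep C) g' g'' ∧ C.wire g'' g ∧ omegaEval C ν g'' = true

/-- A ∪-path from `g'` to `g` that is live under `ν`. -/
def liveUnionPath (C : HybridCircuit α) (ν : α → Bool) (g' g : α) : Prop :=
  ∃ g'', Relation.ReflTransGen
      (fun a b => liveBoxPath C ν a b ∧ C.τ b = GateType.union) g' g'' ∧
    liveBoxPath C ν g'' g

def isExit (C : HybridCircuit α) (g : α) : Prop :=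
  C.τ g = GateType.prod ∨ C.τ g = GateType.svar

/-- The set `D^ν_g` of exits having a live ∪-path to `g` under `ν`. -/
def exitsOf (C : HybridCircuit α) (ν : α → Bool) (g : α) : Set α :=
  {g' | isExit C g' ∧ liveUnionPath C ν g' g}

def deterministic (C : HybridCircuit α) : Prop :=
  ∀ (ν : α → Bool), ∀ g ∈ C.gates, C.τ g = GateType.union →
    ∀ g₁ g₂, C.wire g₁ g → C.wire g₂ g → g₁ ≠ g₂ →
      Disjoint (sval C ν g₁) (sval C ν g₂)

def decomposable (C : HybridCircuit α) : Prop :=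
  ∀ g ∈ C.gates, C.τ g = GateType.prod →
    ∀ g₁ g₂, C.wire g₁ g → C.wire g₂ g → g₁ ≠ g₂ →
      ∀ v, C.τ v = GateType.svar →
        ¬ (Relation.ReflTransGen C.wire v g₁ ∧ Relation.ReflTransGen C.wire v g₂)

def isDDNNF (C : HybridCircuit α) : Prop := decomposable C ∧ deterministic C

/-- The wire `(g, g')` (with `g` set-valued) is pure under `ν`. -/
def pureWire (C : HybridCircuit α) (ν : α → Bool) (g g' : α) : Prop :=
  C.wire g g' ∧ ¬ (C.τ g).isBoolean ∧
    (C.τ g' = GateType.union ∨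
     (C.τ g' = GateType.box ∧
       ∀ g'', C.wire g'' g' → (C.τ g'').isBoolean → bval C ν g'' = true) ∨
     (C.τ g' = GateType.prod ∧ ∃ g'', C.wire g'' g' ∧ g'' ≠ g ∧ (∅ : Set α) ∈ sval C ν g''))

def upwardsDeterministic (C : HybridCircuit α) : Prop :=
  ∀ (ν : α → Bool) (g g₁ g₂ : α), pureWire C ν g g₁ → pureWire C ν g g₂ → g₁ = g₂

def homogenized (C : HybridCircuit α) : Prop :=
  ¬ ∃ (ν : α → Bool) (g : α), g ∈ C.gates ∧ ¬ (C.τ g).isBoolean ∧ (∅ : Set α) ∈ sval C ν g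

noncomputable def fanIn (C : HybridCircuit α) (g : α) : ℕ := {g' | C.wire g' g}.ncard

noncomputable def maxFanIn (C : HybridCircuit α) : ℕ := C.gates.sup (fanIn C)

/-- `Δ(g)`: the gates to which `g` has a directed path. -/
def deltaSet (C : HybridCircuit α) (g : α) : Set α := {g' | Relation.ReflTransGen C.wire g g'}

/-- The dependency size `Δ(C)`. -/
noncomputable def depSize (C : HybridCircuit α) : ℕ :=
  C.gates.sup fun g => (deltaSet C g).ncard

end MSOEnum

namespace MSOEnum

/-- The alphabet Σ = {enu, upd, fix}. -/
inductive EUF : Type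
  | enu | upd | fixLab
  deriving DecidableEq

/-- Full binary labeled trees. -/
inductive BTree (σ : Type) : Type
  | leaf (a : σ)
  | node (a : σ) (l r : BTree σ)

/-- The label of the node of `T` at position `p` (a path from the root, `false` meaning
first child and `true` second child), or `none` if there is no node at that position. -/
def BTree.labelAt {σ : Type} : BTree σ → List Bool → Option σ
  | .leaf a, [] => some a
  | .node a _ _, [] => some a
  | .node _ l _, false :: p => l.labelAt p
  | .node _ _ r, true :: p => r.labelAt p
  | .leaf _, _ :: _ => none

/-- Number of nodes of a tree. -/
def BTree.size {σ : Type} : BTree σ → ℕ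
  | .leaf _ => 1
  | .node _ l r => 1 + l.size + r.size

/-- Height of a tree. -/
def BTree.height {σ : Type} : BTree σ → ℕ
  | .leaf _ => 1
  | .node _ l r => 1 + max l.height r.height

/-- `T.annotate ν` is the tree `ν(T)`: each node at position `p` gets relabeled
from `λ(p)` to `(λ(p), ν p)`. -/
def BTree.annotate {σ : Type} : BTree σ → (List Bool → Bool) → BTree (σ × Bool)
  | .leaf a, ν => .leaf (a, ν [])
  | .node a l r, ν => .node (a, ν [])
      (l.annotate fun p => ν (false :: p)) (r.annotate fun p => ν (true :: p))

/-- A bottom-up deterministic tree automaton on the alphabet `Λ` with state set `Q`. -/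
structure BDTA (Λ Q : Type) where
  final : Q → Prop
  init : Λ → Q
  trans : Q → Q → Λ → Q

/-- The run of a bDTA on a tree. -/
def BDTA.run {Λ Q : Type} (A : BDTA Λ Q) : BTree Λ → Q
  | .leaf a => A.init a
  | .node a l r => A.trans (A.run l) (A.run r) a

def BDTA.accepts {Λ Q : Type} (A : BDTA Λ Q) (T : BTree Λ) : Prop := A.final (A.run T)

/-- `|A|`: the size of the transition table of a bDTA over Σ̄ = Σ × {0,1} (|Σ̄| = 6). -/
noncomputable def BDTA.size {Λ Q : Type} (_ : BDTA Λ Q) : ℕ := Nat.card Q ^ 2 * 6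

/-- `C` is a provenance circuit of the Σ̄-bDTA `A'` on the Σ-tree `T` (the gates of `C`
live in `List Bool ⊕ ℕ`, the tree positions being embedded via `Sum.inl`):
`C_svar = T_enu`, `C_bvar = T_upd`, and for every Boolean annotation `ν` of `T` that is `0`
on `T_fix`, the automaton `A'` accepts `ν(T)` iff the assignment
`{n ∈ T_enu : ν n = 1}` is captured by the output gate of `C` under (any extension of)
the restriction of `ν` to `T_upd`. -/
def isProvenanceCircuit {Q : Type} (A' : BDTA (EUF × Bool) Q) (T : BTree EUF)
    (C : HybridCircuit (List Bool ⊕ ℕ)) : Prop :=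
  {g | g ∈ C.gates ∧ C.τ g = GateType.svar} =
      Sum.inl '' {p | T.labelAt p = some EUF.enu} ∧
  {g | g ∈ C.gates ∧ C.τ g = GateType.bvar} =
      Sum.inl '' {p | T.labelAt p = some EUF.upd} ∧
  ∀ ν : List Bool → Bool, (∀ p, T.labelAt p = some EUF.fixLab → ν p = false) →
    ∀ νC : List Bool ⊕ ℕ → Bool,
      (∀ p, T.labelAt p = some EUF.upd → νC (Sum.inl p) = ν p) →
      (A'.accepts (T.annotate ν) ↔
        Sum.inl '' {p | T.labelAt p = some EUF.enu ∧ ν p = true} ∈ sval C νC C.out)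

namespace BTree

variable {σ : Type}

/-- The subtree rooted at a position (the leaf reached, if the position is too long). -/
def sub : BTree σ → List Bool → BTree σ
  | T, [] => T
  | .leaf a, _ :: _ => .leaf a
  | .node _ l r, b :: p => if b then r.sub p else l.sub p

theorem sub_nil (T : BTree σ) : T.sub [] = T := by cases T <;> rfl

/-- The set of positions of a tree. -/
def positions (T : BTree σ) : Set (List Bool) := {p | T.labelAt p ≠ none}

theorem labelAt_nil_ne_none (T : BTree σ) : T.labelAt [] ≠ none := by
  cases T <;> simp [labelAt]

theorem positions_leaf (a : σ) : (leaf a).positions = {[]} := by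
  ext p; cases p <;> simp [positions, labelAt]

theorem positions_node (a : σ) (l r : BTree σ) :
    (node a l r).positions =
      insert [] ((false :: ·) '' l.positions ∪ (true :: ·) '' r.positions) := by
  ext p
  rcases p with _ | ⟨_ | _, p⟩ <;> simp [positions, labelAt]

theorem finite_positions (T : BTree σ) : T.positions.Finite := by
  induction T with
  | leaf a => simp [positions_leaf]
  | node a l r hl hr =>
    rw [positions_node]
    exact ((hl.image _).union (hr.image _)).insert _

theorem ncard_positions_le (T : BTree σ) : T.positions.ncard ≤ T.size := by
  induction T with
  | leaf a => simp [positions_leaf, size]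
  | node a l r hl hr =>
    rw [positions_node, size]
    have h₁ := Set.ncard_insert_le ([] : List Bool)
      ((false :: ·) '' l.positions ∪ (true :: ·) '' r.positions)
    have h₂ := Set.ncard_union_le ((false :: ·) '' l.positions) ((true :: ·) '' r.positions)
    have h₃ := Set.ncard_image_le (f := (false :: ·)) l.finite_positions
    have h₄ := Set.ncard_image_le (f := (true :: ·)) r.finite_positions
    omega

theorem one_le_size (T : BTree σ) : 1 ≤ T.size := by
  cases T <;> simp only [size] <;> omega

theorem length_lt_height (T : BTree σ) {p : List Bool} (h : T.labelAt p ≠ none) :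
    p.length < T.height := by
  induction T generalizing p with
  | leaf a => cases p <;> simp_all [labelAt, height]
  | node a l r hl hr =>
    rcases p with _ | ⟨_ | _, p⟩
    · simp [height]
    · have := hl (p := p) h
      simp only [List.length_cons, height]; omega
    · have := hr (p := p) h
      simp only [List.length_cons, height]; omega

/-- A position having a first child is an internal node of the tree. -/
theorem sub_of_child (T : BTree σ) {p : List Bool} (h : T.labelAt (p ++ [false]) ≠ none) :
    T.labelAt (p ++ [true]) ≠ none ∧ ∃ a, T.labelAt p = some a ∧
      T.sub p = .node a (T.sub (p ++ [false])) (T.sub (p ++ [true])) := by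
  induction T generalizing p with
  | leaf a => cases p <;> simp_all [labelAt]
  | node a l r hl hr =>
    rcases p with _ | ⟨_ | _, p⟩
    · simp [labelAt, labelAt_nil_ne_none, sub, sub_nil]
    · simpa [labelAt, sub] using hl (p := p) h
    · simpa [labelAt, sub] using hr (p := p) h

/-- A node without a first child is a leaf of the tree. -/
theorem sub_of_no_child (T : BTree σ) {p : List Bool} {a : σ} (ha : T.labelAt p = some a)
    (h : T.labelAt (p ++ [false]) = none) : T.sub p = .leaf a := by
  induction T generalizing p with
  | leaf a => cases p <;> simp_all [labelAt, sub]
  | node a l r hl hr =>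
    rcases p with _ | ⟨_ | _, p⟩
    · simp [labelAt, labelAt_nil_ne_none] at h
    · simpa [labelAt, sub] using hl (p := p) ha h
    · simpa [labelAt, sub] using hr (p := p) ha h

/-- Bottom-up induction on the positions of a tree. -/
theorem position_induction (T : BTree σ) {P : List Bool → Prop}
    (leaf : ∀ p a, T.labelAt p = some a → T.labelAt (p ++ [false]) = none → P p)
    (node : ∀ p, T.labelAt (p ++ [false]) ≠ none → (∀ b, P (p ++ [b])) → P p)
    {p : List Bool} (hp : T.labelAt p ≠ none) : P p := by
  induction T generalizing p P with
  | leaf a =>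
    cases p with
    | nil => exact leaf [] a rfl rfl
    | cons => simp [labelAt] at hp
  | node a l r hl hr =>
    have Pl : ∀ p, l.labelAt p ≠ none → P (false :: p) := fun p hp =>
      hl (P := fun p => P (false :: p)) (fun p => leaf (false :: p))
        (fun p => node (false :: p)) hp
    have Pr : ∀ p, r.labelAt p ≠ none → P (true :: p) := fun p hp =>
      hr (P := fun p => P (true :: p)) (fun p => leaf (true :: p))
        (fun p => node (true :: p)) hp
    rcases p with _ | ⟨_ | _, p⟩
    · refine node [] l.labelAt_nil_ne_none ?_
      rintro (_ | _)
      · exact Pl [] l.labelAt_nil_ne_none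
      · exact Pr [] r.labelAt_nil_ne_none
    · exact Pl p hp
    · exact Pr p hp

theorem labelAt_below_of_no_child (T : BTree σ) {p : List Bool}
    (h : T.labelAt (p ++ [false]) = none) (b : Bool) (s : List Bool) :
    T.labelAt (p ++ b :: s) = none := by
  induction T generalizing p with
  | leaf a => cases p <;> simp [labelAt]
  | node a l r hl hr =>
    rcases p with _ | ⟨_ | _, p⟩
    · simp [labelAt, labelAt_nil_ne_none] at h
    · exact hl (p := p) h
    · exact hr (p := p) h

theorem annotate_congr (T : BTree σ) {μ ν : List Bool → Bool}
    (h : ∀ p, T.labelAt p ≠ none → μ p = ν p) : T.annotate μ = T.annotate ν := by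
  induction T generalizing μ ν with
  | leaf a => simp [annotate, h [] (by simp [labelAt])]
  | node a l r hl hr =>
    simp only [annotate, h [] (by simp [labelAt])]
    rw [hl fun p hp => h (false :: p) hp, hr fun p hp => h (true :: p) hp]

end BTree

section Semantics

variable (C : HybridCircuit α) (ν : α → Bool) {g : α}

theorem bval_bvar (h : C.τ g = .bvar) : bval C ν g = ν g := by
  rw [bval, WellFounded.fix_eq]; simp [h]

theorem bval_bnot (h : C.τ g = .bnot) :
    bval C ν g = true ↔ ∀ g', C.wire g' g → bval C ν g' = false := by
  rw [bval, WellFounded.fix_eq]; simp [h]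

theorem sval_svar (h : C.τ g = .svar) : sval C ν g = {{g}} := by
  rw [sval, WellFounded.fix_eq]; simp [h]

theorem mem_sval_union (h : C.τ g = .union) {a : Set α} :
    a ∈ sval C ν g ↔ ∃ g', C.wire g' g ∧ a ∈ sval C ν g' := by
  rw [sval, WellFounded.fix_eq]; simp [h]

theorem sval_prod_of_no_input (h : C.τ g = .prod) (hg : ∀ g', ¬ C.wire g' g) :
    sval C ν g = {∅} := by
  rw [sval, WellFounded.fix_eq]; simp [h, hg]

theorem mem_sval_prod (h : C.τ g = .prod) {g' : α} (hg : C.wire g' g) {a : Set α} :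
    a ∈ sval C ν g ↔ ∃ g₁ g₂, C.wire g₁ g ∧ C.wire g₂ g ∧ g₁ ≠ g₂ ∧
      ∃ a₁ ∈ sval C ν g₁, ∃ a₂ ∈ sval C ν g₂, a = a₁ ∪ a₂ := by
  have hg' : ¬ ∀ g', ¬ C.wire g' g := fun h => h g' hg
  rw [sval, WellFounded.fix_eq]
  simp only [h, if_neg hg', Set.mem_ofPred_eq, exists_prop]

theorem mem_sval_box (h : C.τ g = .box) {a : Set α} :
    a ∈ sval C ν g ↔ (∃ g', C.wire g' g ∧ ¬ (C.τ g').isBoolean ∧ a ∈ sval C ν g') ∧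
      ∀ g'', C.wire g'' g → (C.τ g'').isBoolean → bval C ν g'' = true := by
  rw [sval, WellFounded.fix_eq]
  simp only [h, Set.mem_ofPred_eq, exists_prop]

end Semantics

/-- The kinds of gates attached to each node of the tree: the variable of the node, a `×`-gate
without inputs, the negation of the variable, a `⊠`-gate for each value of the variable, a
`∪`-gate for each state, and a `×`-gate for each pair of states of the children. -/
inductive GateKind (Q : Type) : Type
  | var
  | emp
  | neg
  | box (b : Bool)
  | state (q : Q)
  | pair (q : Bool → Q)

/-- The gates of the provenance circuit; `none` is the output gate. -/
abbrev ProvGate (Q : Type) : Type := Option (List Bool × GateKind Q)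

namespace GateKind

variable {Q : Type}

/-- An encoding of the gate kinds in a sum type. -/
def code : GateKind Q → (Bool → Q) ⊕ Q ⊕ Fin 5
  | var => .inr (.inr 0)
  | emp => .inr (.inr 1)
  | neg => .inr (.inr 2)
  | box b => .inr (.inr (if b then 3 else 4))
  | state q => .inr (.inl q)
  | pair q => .inl q

theorem code_injective : Function.Injective (code (Q := Q)) := by
  rintro (_ | _ | _ | (_ | _) | _ | _) (_ | _ | _ | (_ | _) | _ | _) h <;> simp_all [code]

instance [Finite Q] : Finite (GateKind Q) := Finite.of_injective _ code_injective

theorem card_le [Finite Q] [Nonempty Q] : Nat.card (GateKind Q) ≤ 7 * Nat.card Q ^ 2 := by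
  have h₁ := Nat.card_le_card_of_injective _ (code_injective (Q := Q))
  simp only [Nat.card_sum, Nat.card_fun, Nat.card_eq_fintype_card (α := Bool),
    Nat.card_eq_fintype_card (α := Fin 5), Fintype.card_bool, Fintype.card_fin] at h₁
  have h₂ : 0 < Nat.card Q := Nat.card_pos
  nlinarith

end GateKind

section Circuit

open GateKind

variable {Q : Type} (A : BDTA (EUF × Bool) Q) (T : BTree EUF)

/-- The wires of the provenance circuit. -/
inductive ProvWire : ProvGate Q → ProvGate Q → Prop
  | stateOut (q : Q) : A.final q → ProvWire (some ([], state q)) none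
  | pairState (p : List Bool) (q : Bool → Q) : T.labelAt (p ++ [false]) ≠ none →
      ProvWire (some (p, pair q))
        (some (p, state (A.trans (q false) (q true) (EUF.fixLab, false))))
  | statePair (p : List Bool) (q : Bool → Q) (b : Bool) : T.labelAt (p ++ [false]) ≠ none →
      ProvWire (some (p ++ [b], state (q b))) (some (p, pair q))
  | enuTrue (p : List Bool) : T.labelAt p = some EUF.enu →
      ProvWire (some (p, var)) (some (p, state (A.init (EUF.enu, true))))
  | enuFalse (p : List Bool) : T.labelAt p = some EUF.enu →
      ProvWire (some (p, emp)) (some (p, state (A.init (EUF.enu, false))))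
  | fixLeaf (p : List Bool) : T.labelAt p = some EUF.fixLab → T.labelAt (p ++ [false]) = none →
      ProvWire (some (p, emp)) (some (p, state (A.init (EUF.fixLab, false))))
  | boxState (p : List Bool) (b : Bool) : T.labelAt p = some EUF.upd →
      ProvWire (some (p, box b)) (some (p, state (A.init (EUF.upd, b))))
  | empBox (p : List Bool) (b : Bool) : T.labelAt p = some EUF.upd →
      ProvWire (some (p, emp)) (some (p, box b))
  | varBox (p : List Bool) : T.labelAt p = some EUF.upd →
      ProvWire (some (p, var)) (some (p, box true))
  | negBox (p : List Bool) : T.labelAt p = some EUF.upd →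
      ProvWire (some (p, neg)) (some (p, box false))
  | varNeg (p : List Bool) : T.labelAt p = some EUF.upd →
      ProvWire (some (p, var)) (some (p, neg))

/-- The type of each gate of the provenance circuit. -/
def provType : ProvGate Q → GateType
  | none => .union
  | some (p, var) => if T.labelAt p = some EUF.enu then .svar else .bvar
  | some (_, emp) => .prod
  | some (_, neg) => .bnot
  | some (_, box _) => .box
  | some (_, state _) => .union
  | some (_, pair _) => .prod

/-- The gates which occur in the provenance circuit. -/
def provValid : ProvGate Q → Prop
  | none => True
  | some (p, var) => T.labelAt p = some EUF.enu ∨ T.labelAt p = some EUF.upd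
  | some (p, neg) => T.labelAt p = some EUF.upd
  | some (p, box _) => T.labelAt p = some EUF.upd
  | some (p, _) => T.labelAt p ≠ none

/-- A rank which increases along the wires of the provenance circuit. -/
def provRank : ProvGate Q → ℕ
  | none => 5 * T.height + 5
  | some (p, var) => 5 * (T.height - p.length)
  | some (p, emp) => 5 * (T.height - p.length)
  | some (p, neg) => 5 * (T.height - p.length) + 1
  | some (p, box _) => 5 * (T.height - p.length) + 2
  | some (p, state _) => 5 * (T.height - p.length) + 4
  | some (p, pair _) => 5 * (T.height - p.length) + 3

/-- The gates attached to nodes in `P`, and the output gate. -/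
def gatesOver (Q : Type) (P : Set (List Bool)) : Set (ProvGate Q) := {g | ∀ x ∈ g, x.1 ∈ P}

theorem gatesOver_eq (P : Set (List Bool)) :
    gatesOver Q P = insert none (some '' (P ×ˢ (Set.univ : Set (GateKind Q)))) := by
  ext (_ | ⟨p, k⟩) <;> simp [gatesOver]

theorem finite_gatesOver [Finite Q] {P : Set (List Bool)} (hP : P.Finite) :
    (gatesOver Q P).Finite := by
  rw [gatesOver_eq]
  exact ((hP.prod Set.finite_univ).image _).insert _

theorem ncard_gatesOver_le [Finite Q] [Nonempty Q] {P : Set (List Bool)} (hP : P.Finite)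
    {n : ℕ} (hn : P.ncard ≤ n) :
    (gatesOver Q P).ncard ≤ 1 + 7 * n * Nat.card Q ^ 2 := by
  rw [gatesOver_eq]
  have h₁ := Set.ncard_insert_le none (some '' (P ×ˢ (Set.univ : Set (GateKind Q))))
  have h₂ := Set.ncard_image_le (f := some)
    (hP.prod (Set.finite_univ (α := GateKind Q)))
  rw [Set.ncard_prod, Set.ncard_univ] at h₂
  have h₃ := Nat.mul_le_mul hn (card_le (Q := Q))
  linarith

theorem provValid_subset : {g : ProvGate Q | provValid T g} ⊆ gatesOver Q T.positions := by
  rintro (_ | ⟨p, _ | _ | _ | _ | _ | _⟩) h <;>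
    simp_all [provValid, gatesOver, BTree.positions]
  rcases h with h | h <;> simp [h]

variable {A T}

theorem ProvWire.valid {g g' : ProvGate Q} (h : ProvWire A T g g') :
    provValid T g ∧ provValid T g' := by
  cases h with
  | stateOut q h => exact ⟨T.labelAt_nil_ne_none, trivial⟩
  | pairState p q h =>
    obtain ⟨_, a, ha, _⟩ := T.sub_of_child h
    simp [provValid, ha]
  | statePair p q b h =>
    obtain ⟨h', a, ha, _⟩ := T.sub_of_child h
    cases b <;> simp_all [provValid]
  | _ => simp_all [provValid]

theorem ProvWire.rank_lt {g g' : ProvGate Q} (h : ProvWire A T g g') :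
    provRank T g < provRank T g' := by
  cases h with
  | statePair p q b h =>
    have := T.length_lt_height h
    simp only [provRank, List.length_append, List.length_singleton] at this ⊢
    omega
  | _ => simp [provRank]

theorem ProvWire.positions_nested {g g' : ProvGate Q} (h : ProvWire A T g g') :
    ∀ x ∈ g', ∃ y ∈ g, x.1 <+: y.1 := by
  cases h <;> simp

theorem ProvWire.of_state {s : List Bool} {q : Q} {g : ProvGate Q}
    (h : ProvWire A T (some (s, state q)) g) :
    (s = [] ∧ g = none) ∨ ∃ p b r, s = p ++ [b] ∧ r b = q ∧
      T.labelAt (p ++ [false]) ≠ none ∧ g = some (p, pair r) := by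
  generalize hg : (some (s, state q) : ProvGate Q) = g' at h
  cases h with
  | stateOut => simp_all
  | statePair p r b hp =>
    simp only [Option.some.injEq, Prod.mk.injEq, state.injEq] at hg
    exact .inr ⟨p, b, r, hg.1, hg.2.symm, hp, rfl⟩
  | _ => simp at hg

theorem nested_of_path {g g' : ProvGate Q} (h : Relation.ReflTransGen (ProvWire A T) g g') :
    ∀ x ∈ g', ∃ y ∈ g, x.1 <+: y.1 := by
  induction h with
  | refl => exact fun x hx => ⟨x, hx, List.prefix_rfl⟩
  | tail _ hw ih =>
    intro x hx
    obtain ⟨y, hy, hxy⟩ := hw.positions_nested x hx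
    obtain ⟨z, hz, hyz⟩ := ih y hy
    exact ⟨z, hz, hxy.trans hyz⟩

theorem inputs_subset (g : ProvGate Q) :
    ∃ p, {g' | ProvWire A T g' g} ⊆ gatesOver Q {p, p ++ [false], p ++ [true]} := by
  rcases g with _ | ⟨p, k⟩
  · refine ⟨[], ?_⟩
    rintro _ ⟨⟩
    simp [gatesOver]
  · refine ⟨p, ?_⟩
    intro g' hw
    cases hw with
    | statePair _ _ b => cases b <;> simp [gatesOver]
    | _ => simp [gatesOver]

variable (A T)

/-- The provenance circuit, its gates being renamed by `e`. -/
noncomputable def provCircuit [Finite Q] (e : ProvGate Q ↪ α) : HybridCircuit α where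
  gates := (((finite_gatesOver T.finite_positions).subset
    (provValid_subset (Q := Q) T)).image e).toFinset
  wire := Relation.Map (ProvWire A T) e e
  wire_mem := by
    rintro _ _ ⟨g, g', h, rfl, rfl⟩
    simpa using h.valid
  acyclic := by
    have h : WellFounded (ProvWire A T) :=
      Subrelation.wf (fun h => ProvWire.rank_lt h) (measure (provRank T)).wf
    refine ⟨fun x => ⟨x, ?_⟩⟩
    rintro _ ⟨g, g', -, rfl, -⟩
    induction g using h.induction with
    | _ g ih =>
      refine ⟨_, ?_⟩
      rintro _ ⟨g₁, g₂, hw, rfl, hg⟩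
      exact ih g₁ (e.injective hg ▸ hw)
  τ := Function.extend e (provType T) fun _ => .union
  out := e none
  out_mem := by simp [provValid]
  out_setValued := by simp [e.injective.extend_apply, provType, GateType.isBoolean]
  var_no_input := by
    rintro _ h _ ⟨g, g', hw, rfl, rfl⟩
    rw [e.injective.extend_apply] at h
    cases hw <;> simp [provType] at h
  boolGate_inputs := by
    rintro _ h _ ⟨g, g', hw, rfl, rfl⟩
    rw [e.injective.extend_apply] at h ⊢
    cases hw <;> simp_all [provType, GateType.isBoolean]
  bnot_input := by
    simp only [Set.Finite.mem_toFinset, Set.forall_mem_image, e.injective.extend_apply]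
    rintro (_ | ⟨p, _ | _ | _ | _ | _ | _⟩) hv h <;> simp [provType] at h
    · split_ifs at h
    · refine ⟨e (some (p, var)), ⟨_, _, .varNeg p hv, rfl, rfl⟩, ?_⟩
      rintro _ ⟨g, g', hw, rfl, hg⟩
      obtain rfl := e.injective hg
      cases hw; rfl
  setGate_inputs := by
    rintro _ h _ ⟨g, g', hw, rfl, rfl⟩
    rw [e.injective.extend_apply] at h ⊢
    cases hw <;> simp_all [provType, GateType.isBoolean]
  prod_inputs := by
    simp only [Set.Finite.mem_toFinset, Set.forall_mem_image, e.injective.extend_apply]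
    rintro (_ | ⟨p, _ | _ | _ | _ | _ | q⟩) hv h <;> simp [provType] at h
    · split_ifs at h
    · left
      rintro _ ⟨g, g', hw, rfl, hg⟩
      obtain rfl := e.injective hg
      cases hw
    · by_cases hp : T.labelAt (p ++ [false]) = none
      · left
        rintro _ ⟨g, g', hw, rfl, hg⟩
        obtain rfl := e.injective hg
        cases hw; contradiction
      · right
        refine ⟨_, _, ?_, ⟨_, _, .statePair p q false hp, rfl, rfl⟩,
          ⟨_, _, .statePair p q true hp, rfl, rfl⟩, ?_⟩
        · simp
        · rintro _ ⟨g, g', hw, rfl, hg⟩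
          obtain rfl := e.injective hg
          cases hw with
          | statePair _ _ b => cases b <;> simp
  box_inputs := by
    simp only [Set.Finite.mem_toFinset, Set.forall_mem_image, e.injective.extend_apply]
    rintro (_ | ⟨p, _ | _ | _ | b | _ | _⟩) hv h <;> simp [provType] at h
    · split_ifs at h
    · replace hv : T.labelAt p = some EUF.upd := hv
      refine ⟨_, e (some (p, if b then var else neg)), ?_, ?_,
        ⟨_, _, .empBox p b hv, rfl, rfl⟩, ?_, ?_⟩
      · simp [e.injective.extend_apply, provType, GateType.isBoolean]
      · cases b <;> rw [e.injective.extend_apply] <;> simp [provType, GateType.isBoolean, hv]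
      · cases b
        · exact ⟨_, _, .negBox p hv, rfl, rfl⟩
        · exact ⟨_, _, .varBox p hv, rfl, rfl⟩
      · rintro _ ⟨g, g', hw, rfl, hg⟩
        obtain rfl := e.injective hg
        cases hw <;> simp

end Circuit

section State

variable {Q : Type} (A : BDTA (EUF × Bool) Q) (T : BTree EUF) (ν : List Bool ⊕ ℕ → Bool)

open Classical in
/-- The annotation of `T` given by an assignment on the nodes labeled `enu` and by a valuation
on the nodes labeled `upd`. -/
noncomputable def assignAnnot (a : Set (List Bool ⊕ ℕ)) (p : List Bool) : Bool :=
  match T.labelAt p with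
  | some EUF.enu => decide (Sum.inl p ∈ a)
  | some EUF.upd => ν (Sum.inl p)
  | _ => false

/-- The state reached at position `p` under an assignment and a valuation. -/
noncomputable def stateAt (p : List Bool) (a : Set (List Bool ⊕ ℕ)) : Q :=
  A.run ((T.sub p).annotate fun s => assignAnnot T ν a (p ++ s))

/-- The variables of the nodes labeled `enu` at and below `p`. -/
def enuBelow (p : List Bool) : Set (List Bool ⊕ ℕ) :=
  Sum.inl '' {s | p <+: s ∧ T.labelAt s = some EUF.enu}

variable {T ν}

theorem inl_mem_enuBelow {p s : List Bool} :
    Sum.inl s ∈ enuBelow T p ↔ p <+: s ∧ T.labelAt s = some EUF.enu := by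
  simp [enuBelow]

theorem enuBelow_mono {p s : List Bool} (h : p <+: s) : enuBelow T s ⊆ enuBelow T p := by
  rintro _ ⟨t, ht, rfl⟩
  exact inl_mem_enuBelow.2 ⟨h.trans ht.1, ht.2⟩

theorem disjoint_enuBelow {p : List Bool} {b b' : Bool} (h : b ≠ b') :
    Disjoint (enuBelow T (p ++ [b])) (enuBelow T (p ++ [b'])) := by
  rw [Set.disjoint_left]
  rintro _ ⟨_, ⟨⟨s, rfl⟩, -⟩, rfl⟩ hb
  have := (inl_mem_enuBelow.1 hb).1
  simp only [List.append_assoc, List.prefix_append_right_inj, List.singleton_append,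
    List.cons_prefix_cons] at this
  exact h this.1.symm

theorem enuBelow_eq_union {p : List Bool} (h : T.labelAt p ≠ some EUF.enu) :
    enuBelow T p = enuBelow T (p ++ [false]) ∪ enuBelow T (p ++ [true]) := by
  refine Set.Subset.antisymm ?_
    (Set.union_subset (enuBelow_mono (by simp)) (enuBelow_mono (by simp)))
  rintro _ ⟨_, ⟨⟨s, rfl⟩, hs⟩, rfl⟩
  rcases s with _ | ⟨_ | _, s⟩
  · simp [h] at hs
  · exact .inl (inl_mem_enuBelow.2 ⟨by simp, hs⟩)
  · exact .inr (inl_mem_enuBelow.2 ⟨by simp, hs⟩)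

theorem enuBelow_leaf {p : List Bool} (h : T.labelAt (p ++ [false]) = none) :
    enuBelow T p = {x | x = Sum.inl p ∧ T.labelAt p = some EUF.enu} := by
  ext x
  constructor
  · rintro ⟨_, ⟨⟨_ | ⟨b, s⟩, rfl⟩, hs⟩, rfl⟩
    · simpa using hs
    · simp [T.labelAt_below_of_no_child h] at hs
  · rintro ⟨rfl, hp⟩
    exact inl_mem_enuBelow.2 ⟨List.prefix_rfl, hp⟩

theorem stateAt_congr {p : List Bool} {a a' : Set (List Bool ⊕ ℕ)}
    (h : a ∩ enuBelow T p = a' ∩ enuBelow T p) : stateAt A T ν p a = stateAt A T ν p a' := by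
  have : (fun s => assignAnnot T ν a (p ++ s)) = fun s => assignAnnot T ν a' (p ++ s) := by
    funext s
    unfold assignAnnot
    split
    · next hs =>
      have hm : Sum.inl (p ++ s) ∈ enuBelow T p := inl_mem_enuBelow.2 ⟨by simp, hs⟩
      have := Set.ext_iff.1 h (Sum.inl (p ++ s))
      simpa [hm] using this
    · rfl
    · rfl
  rw [stateAt, stateAt, this]

theorem stateAt_node {p : List Bool} (h : T.labelAt (p ++ [false]) ≠ none)
    (hp : T.labelAt p = some EUF.fixLab) (a : Set (List Bool ⊕ ℕ)) :
    stateAt A T ν p a = A.trans (stateAt A T ν (p ++ [false]) a)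
      (stateAt A T ν (p ++ [true]) a) (EUF.fixLab, false) := by
  obtain ⟨-, x, hx, hs⟩ := T.sub_of_child h
  obtain rfl : x = EUF.fixLab := by simpa [hp] using hx.symm
  have h₀ : assignAnnot T ν a p = false := by simp [assignAnnot, hp]
  simp only [stateAt, hs, BTree.annotate, BDTA.run, List.append_nil, h₀, List.append_assoc,
    List.singleton_append]

theorem stateAt_leaf {p : List Bool} {x : EUF} (hx : T.labelAt p = some x)
    (h : T.labelAt (p ++ [false]) = none) (a : Set (List Bool ⊕ ℕ)) :
    stateAt A T ν p a = A.init (x, assignAnnot T ν a p) := by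
  simp [stateAt, T.sub_of_no_child hx h, BTree.annotate, BDTA.run]

end State

section Correctness

open GateKind

variable {Q : Type} [Finite Q] (A : BDTA (EUF × Bool) Q) (T : BTree EUF)
  (e : ProvGate Q ↪ List Bool ⊕ ℕ)

theorem provCircuit_type (g : ProvGate Q) : (provCircuit A T e).τ (e g) = provType T g :=
  e.injective.extend_apply (provType T) (fun _ => .union) g

theorem provCircuit_wire {x : List Bool ⊕ ℕ} {g : ProvGate Q} :
    (provCircuit A T e).wire x (e g) ↔ ∃ g', e g' = x ∧ ProvWire A T g' g := by
  constructor
  · rintro ⟨g', g'', h, rfl, hg⟩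
    exact ⟨g', rfl, e.injective hg ▸ h⟩
  · rintro ⟨g', rfl, h⟩
    exact ⟨g', g, h, rfl, rfl⟩

variable {T} (ν : List Bool ⊕ ℕ → Bool)

theorem sval_var (he : ∀ p, e (some (p, var)) = Sum.inl p) {p : List Bool}
    (hp : T.labelAt p = some EUF.enu) :
    sval (provCircuit A T e) ν (e (some (p, var))) = {{Sum.inl p}} := by
  rw [sval_svar, he]
  simp [provCircuit_type, provType, hp]

theorem sval_emp (p : List Bool) : sval (provCircuit A T e) ν (e (some (p, emp))) = {∅} := by
  refine sval_prod_of_no_input _ _ (provCircuit_type A T e _) fun x hx => ?_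
  obtain ⟨g, -, hg⟩ := (provCircuit_wire A T e).1 hx
  cases hg

theorem bval_box_inputs (he : ∀ p, e (some (p, var)) = Sum.inl p) {p : List Bool}
    (hp : T.labelAt p = some EUF.upd) (b : Bool) :
    (∀ x, (provCircuit A T e).wire x (e (some (p, box b))) →
      ((provCircuit A T e).τ x).isBoolean → bval (provCircuit A T e) ν x = true) ↔
      ν (Sum.inl p) = b := by
  have hvar : bval (provCircuit A T e) ν (e (some (p, var))) = ν (Sum.inl p) := by
    rw [bval_bvar, he]
    simp [provCircuit_type, provType, hp]
  have hneg : bval (provCircuit A T e) ν (e (some (p, neg))) = true ↔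
      ν (Sum.inl p) = false := by
    rw [bval_bnot _ _ (provCircuit_type A T e _)]
    constructor
    · intro h
      rw [← hvar]
      exact h _ ((provCircuit_wire A T e).2 ⟨_, rfl, .varNeg p hp⟩)
    · rintro h x hx
      obtain ⟨g, rfl, hg⟩ := (provCircuit_wire A T e).1 hx
      cases hg
      rw [hvar, h]
  constructor
  · intro h
    cases b
    · rw [← hneg]
      refine h _ ((provCircuit_wire A T e).2 ⟨_, rfl, .negBox p hp⟩) ?_
      simp [provCircuit_type, provType, GateType.isBoolean]
    · rw [← hvar]
      refine h _ ((provCircuit_wire A T e).2 ⟨_, rfl, .varBox p hp⟩) ?_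
      simp [provCircuit_type, provType, GateType.isBoolean, hp]
  · intro h x hx hb
    obtain ⟨g, rfl, hg⟩ := (provCircuit_wire A T e).1 hx
    cases hg with
    | empBox => simp [provCircuit_type, provType, GateType.isBoolean] at hb
    | varBox => rw [hvar, h]
    | negBox => rw [hneg, h]

theorem mem_sval_box_gate (he : ∀ p, e (some (p, var)) = Sum.inl p) {p : List Bool}
    (hp : T.labelAt p = some EUF.upd) (b : Bool) {a : Set (List Bool ⊕ ℕ)} :
    a ∈ sval (provCircuit A T e) ν (e (some (p, box b))) ↔ a = ∅ ∧ ν (Sum.inl p) = b := by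
  rw [mem_sval_box _ _ (provCircuit_type A T e _), bval_box_inputs A e ν he hp]
  refine and_congr_left' ⟨?_, ?_⟩
  · rintro ⟨x, hx, hb, ha⟩
    obtain ⟨g, rfl, hg⟩ := (provCircuit_wire A T e).1 hx
    cases hg with
    | empBox => simpa [sval_emp] using ha
    | _ => simp [provCircuit_type, provType, GateType.isBoolean, hp] at hb
  · rintro rfl
    refine ⟨_, (provCircuit_wire A T e).2 ⟨_, rfl, .empBox p b hp⟩, ?_, ?_⟩
    · simp [provCircuit_type, provType, GateType.isBoolean]
    · simp [sval_emp]

/-- The semantics of a pair gate, given that of the state gates of the children. -/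
theorem sval_pair {p : List Bool} (hp : T.labelAt (p ++ [false]) ≠ none)
    (hfix : T.labelAt p = some EUF.fixLab)
    (ih : ∀ b q, sval (provCircuit A T e) ν (e (some (p ++ [b], state q))) =
      {a | a ⊆ enuBelow T (p ++ [b]) ∧ stateAt A T ν (p ++ [b]) a = q})
    (q : Bool → Q) :
    sval (provCircuit A T e) ν (e (some (p, pair q))) =
      {a | a ⊆ enuBelow T p ∧ ∀ b, stateAt A T ν (p ++ [b]) a = q b} := by
  have hU := enuBelow_eq_union (T := T) (p := p) (by simp [hfix])
  have hw : ∀ b, (provCircuit A T e).wire (e (some (p ++ [b], state (q b))))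
      (e (some (p, pair q))) := fun b =>
    (provCircuit_wire A T e).2 ⟨_, rfl, .statePair p q b hp⟩
  ext a
  rw [mem_sval_prod _ _ (provCircuit_type A T e _) (hw false), Set.mem_ofPred_eq]
  constructor
  · rintro ⟨x₁, x₂, h₁, h₂, hne, a₁, ha₁, a₂, ha₂, rfl⟩
    obtain ⟨_, rfl, hg₁⟩ := (provCircuit_wire A T e).1 h₁
    obtain ⟨_, rfl, hg₂⟩ := (provCircuit_wire A T e).1 h₂
    cases hg₁ with
    | statePair _ _ b₁ =>
    cases hg₂ with
    | statePair _ _ b₂ =>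
    rw [ih] at ha₁ ha₂
    have hb : b₁ ≠ b₂ := by rintro rfl; exact hne rfl
    have hsub : ∀ b, enuBelow T (p ++ [b]) ⊆ enuBelow T p := fun b => enuBelow_mono (by simp)
    refine ⟨Set.union_subset (ha₁.1.trans (hsub _)) (ha₂.1.trans (hsub _)), fun b => ?_⟩
    have hcase : b = b₁ ∨ b = b₂ := by cases b <;> cases b₁ <;> cases b₂ <;> simp_all
    rcases hcase with rfl | rfl
    · rw [← ha₁.2]
      refine stateAt_congr A ?_
      rw [Set.union_inter_distrib_right,
        ((disjoint_enuBelow hb).symm.mono_left ha₂.1).inter_eq, Set.union_empty]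
    · rw [← ha₂.2]
      refine stateAt_congr A ?_
      rw [Set.union_inter_distrib_right,
        ((disjoint_enuBelow hb).mono_left ha₁.1).inter_eq, Set.empty_union]
  · rintro ⟨hsub, hst⟩
    have hmem : ∀ b, a ∩ enuBelow T (p ++ [b]) ∈
        sval (provCircuit A T e) ν (e (some (p ++ [b], state (q b)))) := by
      intro b
      rw [ih, ← hst b]
      refine ⟨Set.inter_subset_right, stateAt_congr A ?_⟩
      rw [Set.inter_assoc, Set.inter_self]
    refine ⟨_, _, hw false, hw true, by simp, _, hmem false, _, hmem true, ?_⟩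
    rw [← Set.inter_union_distrib_left, ← hU, Set.inter_eq_left.2 hsub]

theorem mem_sval_union_gate {g : ProvGate Q} (hg : provType T g = .union)
    {a : Set (List Bool ⊕ ℕ)} :
    a ∈ sval (provCircuit A T e) ν (e g) ↔
      ∃ g', ProvWire A T g' g ∧ a ∈ sval (provCircuit A T e) ν (e g') := by
  rw [mem_sval_union _ _ ((provCircuit_type A T e g).trans hg)]
  constructor
  · rintro ⟨x, hx, ha⟩
    obtain ⟨g', rfl, hw⟩ := (provCircuit_wire A T e).1 hx
    exact ⟨g', hw, ha⟩
  · rintro ⟨g', hw, ha⟩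
    exact ⟨_, (provCircuit_wire A T e).2 ⟨g', rfl, hw⟩, ha⟩

theorem sval_state
    (hT : ∀ p : List Bool, T.labelAt (p ++ [false]) ≠ none → T.labelAt p = some EUF.fixLab)
    (he : ∀ p, e (some (p, var)) = Sum.inl p) {p : List Bool}
    (hp : T.labelAt p ≠ none) (q : Q) :
    sval (provCircuit A T e) ν (e (some (p, state q))) =
      {a | a ⊆ enuBelow T p ∧ stateAt A T ν p a = q} := by
  revert q
  refine T.position_induction (P := fun p => ∀ q, sval (provCircuit A T e) ν
    (e (some (p, state q))) = {a | a ⊆ enuBelow T p ∧ stateAt A T ν p a = q}) ?_ ?_ hp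
  · intro p x hx hleaf q
    ext a
    rw [mem_sval_union_gate A e ν rfl, enuBelow_leaf hleaf, Set.mem_ofPred_eq,
      stateAt_leaf A hx hleaf]
    constructor
    · rintro ⟨g, hw, ha⟩
      cases hw with
      | pairState => contradiction
      | enuTrue _ hl =>
        rw [sval_var A e ν he hl, Set.mem_singleton_iff] at ha
        obtain rfl : x = EUF.enu := by simpa [hx] using hl
        subst ha
        simp [assignAnnot, hx]
      | enuFalse _ hl =>
        rw [sval_emp, Set.mem_singleton_iff] at ha
        obtain rfl : x = EUF.enu := by simpa [hx] using hl
        subst ha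
        simp [assignAnnot, hx]
      | fixLeaf _ hl =>
        rw [sval_emp, Set.mem_singleton_iff] at ha
        obtain rfl : x = EUF.fixLab := by simpa [hx] using hl
        subst ha
        simp [assignAnnot, hx]
      | boxState _ b hl =>
        rw [mem_sval_box_gate A e ν he hl] at ha
        obtain rfl : x = EUF.upd := by simpa [hx] using hl
        obtain ⟨rfl, rfl⟩ := ha
        simp [assignAnnot, hx]
    · rintro ⟨ha, rfl⟩
      cases x with
      | enu =>
        replace ha : a ⊆ {Sum.inl p} := fun y hy => (ha hy).1
        rcases Set.subset_singleton_iff_eq.1 ha with rfl | rfl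
        · refine ⟨some (p, emp), ?_, by simp [sval_emp]⟩
          simpa [assignAnnot, hx] using ProvWire.enuFalse (A := A) p hx
        · refine ⟨some (p, var), ?_, by simp [sval_var A e ν he hx]⟩
          simpa [assignAnnot, hx] using ProvWire.enuTrue (A := A) p hx
      | upd =>
        obtain rfl : a = ∅ := by simpa [hx, Set.subset_empty_iff] using ha
        refine ⟨some (p, box (ν (Sum.inl p))), ?_, by simp [mem_sval_box_gate A e ν he hx]⟩
        simpa [assignAnnot, hx] using ProvWire.boxState (A := A) p (ν (Sum.inl p)) hx
      | fixLab =>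
        obtain rfl : a = ∅ := by simpa [hx, Set.subset_empty_iff] using ha
        refine ⟨some (p, emp), ?_, by simp [sval_emp]⟩
        simpa [assignAnnot, hx] using ProvWire.fixLeaf (A := A) p hx hleaf
  · intro p hp ih q
    have hpair := sval_pair A e ν hp (hT p hp) ih
    ext a
    rw [mem_sval_union_gate A e ν rfl, Set.mem_ofPred_eq, stateAt_node A hp (hT p hp)]
    constructor
    · rintro ⟨g, hw, ha⟩
      cases hw with
      | pairState _ q =>
        rw [hpair] at ha
        exact ⟨ha.1, by rw [ha.2, ha.2]⟩
      | fixLeaf => contradiction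
      | _ => simp_all
    · rintro ⟨ha, rfl⟩
      refine ⟨_, .pairState p (fun b => stateAt A T ν (p ++ [b]) a) hp, ?_⟩
      rw [hpair]
      exact ⟨ha, fun _ => rfl⟩

theorem mem_sval_out
    (hT : ∀ p : List Bool, T.labelAt (p ++ [false]) ≠ none → T.labelAt p = some EUF.fixLab)
    (he : ∀ p, e (some (p, var)) = Sum.inl p) {a : Set (List Bool ⊕ ℕ)} :
    a ∈ sval (provCircuit A T e) ν (e none) ↔
      a ⊆ enuBelow T [] ∧ A.final (stateAt A T ν [] a) := by
  rw [mem_sval_union_gate A e ν rfl]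
  constructor
  · rintro ⟨_, ⟨q, hq⟩, ha⟩
    rw [sval_state A e ν hT he T.labelAt_nil_ne_none] at ha
    exact ⟨ha.1, ha.2.symm ▸ hq⟩
  · rintro ⟨ha, hf⟩
    refine ⟨_, .stateOut _ hf, ?_⟩
    rw [sval_state A e ν hT he T.labelAt_nil_ne_none]
    exact ⟨ha, rfl⟩

theorem mem_provCircuit_gates {x : List Bool ⊕ ℕ} :
    x ∈ (provCircuit A T e).gates ↔ ∃ g, provValid T g ∧ e g = x := by
  simp [provCircuit]

theorem isProvenanceCircuit_provCircuit
    (hT : ∀ p : List Bool, T.labelAt (p ++ [false]) ≠ none → T.labelAt p = some EUF.fixLab)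
    (he : ∀ p, e (some (p, var)) = Sum.inl p) :
    isProvenanceCircuit A T (provCircuit A T e) := by
  refine ⟨?_, ?_, ?_⟩
  · ext x
    simp only [mem_provCircuit_gates, Set.mem_ofPred_eq, Set.mem_image]
    constructor
    · rintro ⟨⟨g, -, rfl⟩, hg⟩
      rw [provCircuit_type] at hg
      rcases g with _ | ⟨p, _ | _ | _ | _ | _ | _⟩ <;> simp [provType] at hg
      exact ⟨p, hg, (he p).symm⟩
    · rintro ⟨p, hp, rfl⟩
      refine ⟨⟨some (p, var), .inl hp, he p⟩, ?_⟩
      rw [← he, provCircuit_type]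
      simp [provType, hp]
  · ext x
    simp only [mem_provCircuit_gates, Set.mem_ofPred_eq, Set.mem_image]
    constructor
    · rintro ⟨⟨g, hv, rfl⟩, hg⟩
      rw [provCircuit_type] at hg
      rcases g with _ | ⟨p, _ | _ | _ | _ | _ | _⟩ <;> simp [provType] at hg
      exact ⟨p, hv.resolve_left hg, (he p).symm⟩
    · rintro ⟨p, hp, rfl⟩
      refine ⟨⟨some (p, var), .inr hp, he p⟩, ?_⟩
      rw [← he, provCircuit_type]
      simp [provType, hp]
  · intro μ hfix ν hν
    refine Iff.trans ?_ (mem_sval_out A e ν hT he).symm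
    have hsub : (Sum.inl '' {p | T.labelAt p = some EUF.enu ∧ μ p = true} :
        Set (List Bool ⊕ ℕ)) ⊆ enuBelow T [] := by
      rintro _ ⟨p, hp, rfl⟩
      exact inl_mem_enuBelow.2 ⟨by simp, hp.1⟩
    rw [and_iff_right hsub, stateAt, T.sub_nil, BDTA.accepts,
      T.annotate_congr (μ := μ) fun p hp => ?_]
    simp only [List.nil_append, assignAnnot]
    split
    · next h => cases hb : μ p <;> simp [h, hb]
    · next h => exact (hν p h).symm
    · next h₁ h₂ =>
      refine hfix p ?_
      obtain ⟨_ | _ | _, hx⟩ := Option.ne_none_iff_exists'.1 hp <;> simp_all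

theorem exists_path_of_path {g : ProvGate Q} {x : List Bool ⊕ ℕ}
    (h : Relation.ReflTransGen (provCircuit A T e).wire (e g) x) :
    ∃ g', e g' = x ∧ Relation.ReflTransGen (ProvWire A T) g g' := by
  induction h with
  | refl => exact ⟨g, rfl, .refl⟩
  | tail _ hw ih =>
    obtain ⟨g₁, g₂, h, h₁, rfl⟩ := hw
    obtain ⟨g', h', hp⟩ := ih
    obtain rfl := e.injective (h'.trans h₁.symm)
    exact ⟨g₂, rfl, hp.tail h⟩

theorem nested_of_provCircuit_path {g : ProvGate Q} {p : List Bool} {k : GateKind Q}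
    (h : Relation.ReflTransGen (provCircuit A T e).wire (e g) (e (some (p, k)))) :
    ∃ y ∈ g, p <+: y.1 := by
  obtain ⟨g', hg', hp⟩ := exists_path_of_path A e h
  obtain rfl := e.injective hg'
  exact nested_of_path hp (p, k) rfl

theorem decomposable_provCircuit : decomposable (provCircuit A T e) := by
  intro x hx hprod x₁ x₂ h₁ h₂ hne v hv
  rintro ⟨hp₁, hp₂⟩
  obtain ⟨g, -, rfl⟩ := (mem_provCircuit_gates A e).1 hx
  obtain ⟨g₁, rfl, hw₁⟩ := (provCircuit_wire A T e).1 h₁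
  obtain ⟨g₂, rfl, hw₂⟩ := (provCircuit_wire A T e).1 h₂
  obtain ⟨w, rfl⟩ : ∃ w, e w = v := by
    by_contra hw
    have : (provCircuit A T e).τ v = .union :=
      Function.extend_apply' (provType T) (fun _ => GateType.union) v hw
    simp [this] at hv
  rw [provCircuit_type] at hprod
  rcases g with _ | ⟨p, _ | _ | _ | _ | _ | q⟩ <;> simp [provType] at hprod
  · split_ifs at hprod
  · cases hw₁
  · cases hw₁ with
    | statePair _ _ b₁ =>
    cases hw₂ with
    | statePair _ _ b₂ =>
    obtain ⟨y₁, hy₁, hb₁⟩ := nested_of_provCircuit_path A e hp₁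
    obtain ⟨y₂, hy₂, hb₂⟩ := nested_of_provCircuit_path A e hp₂
    obtain rfl : y₁ = y₂ := Option.mem_unique hy₁ hy₂
    have heq := (List.prefix_of_prefix_length_le hb₁ hb₂ (by simp)).eq_of_length (by simp)
    obtain rfl : b₁ = b₂ := by simpa using heq
    exact hne rfl

/-- The input of a state gate which captures a given assignment is determined by the assignment
and the position of the gate. -/
theorem exists_kind_of_mem_input
    (hT : ∀ p : List Bool, T.labelAt (p ++ [false]) ≠ none → T.labelAt p = some EUF.fixLab)
    (he : ∀ p, e (some (p, var)) = Sum.inl p) (p : List Bool) (a : Set (List Bool ⊕ ℕ)) :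
    ∃ k, ∀ q g, ProvWire A T g (some (p, state q)) → a ∈ sval (provCircuit A T e) ν (e g) →
      g = some (p, k) := by
  by_cases hp : T.labelAt (p ++ [false]) = none
  · refine ⟨if T.labelAt p = some EUF.upd then box (ν (Sum.inl p)) else
      open Classical in if a = ∅ then emp else var, fun q g hw ha => ?_⟩
    cases hw with
    | pairState => contradiction
    | enuTrue _ hl =>
      rw [sval_var A e ν he hl, Set.mem_singleton_iff] at ha
      simp [hl, ha]
    | enuFalse _ hl =>
      rw [sval_emp, Set.mem_singleton_iff] at ha
      simp [hl, ha]
    | fixLeaf _ hl =>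
      rw [sval_emp, Set.mem_singleton_iff] at ha
      simp [hl, ha]
    | boxState _ b hl =>
      rw [mem_sval_box_gate A e ν he hl] at ha
      simp [hl, ha.2]
  · refine ⟨pair fun b => stateAt A T ν (p ++ [b]) a, fun q g hw ha => ?_⟩
    cases hw with
    | pairState _ r _ =>
      obtain ⟨hp', -⟩ := T.sub_of_child hp
      rw [sval_pair A e ν hp (hT p hp) fun b => sval_state A e ν hT he (by cases b <;> assumption)]
        at ha
      simp only [funext ha.2]
    | fixLeaf => contradiction
    | _ => simp_all

theorem deterministic_provCircuit
    (hT : ∀ p : List Bool, T.labelAt (p ++ [false]) ≠ none → T.labelAt p = some EUF.fixLab)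
    (he : ∀ p, e (some (p, var)) = Sum.inl p) : deterministic (provCircuit A T e) := by
  intro ν x hx hunion x₁ x₂ h₁ h₂ hne
  obtain ⟨g, -, rfl⟩ := (mem_provCircuit_gates A e).1 hx
  obtain ⟨g₁, rfl, hw₁⟩ := (provCircuit_wire A T e).1 h₁
  obtain ⟨g₂, rfl, hw₂⟩ := (provCircuit_wire A T e).1 h₂
  rw [provCircuit_type] at hunion
  rw [Set.disjoint_left]
  intro a ha₁ ha₂
  refine hne (congrArg e ?_)
  rcases g with _ | ⟨p, _ | _ | _ | _ | q | _⟩ <;> simp [provType] at hunion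
  · cases hw₁ with
    | stateOut q₁ =>
    cases hw₂ with
    | stateOut q₂ =>
    rw [sval_state A e ν hT he T.labelAt_nil_ne_none] at ha₁ ha₂
    rw [← ha₁.2, ← ha₂.2]
  · split_ifs at hunion
  · obtain ⟨k, hk⟩ := exists_kind_of_mem_input A e ν hT he p a
    rw [hk q g₁ hw₁ ha₁, hk q g₂ hw₂ ha₂]

/-- Each gate has at most one outgoing pure wire. -/
theorem exists_target_of_pureWire
    (hT : ∀ p : List Bool, T.labelAt (p ++ [false]) ≠ none → T.labelAt p = some EUF.fixLab)
    (he : ∀ p, e (some (p, var)) = Sum.inl p) (g : ProvGate Q) :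
    ∃ g₀, ∀ g', ProvWire A T g g' → pureWire (provCircuit A T e) ν (e g) (e g') → g' = g₀ := by
  rcases g with _ | ⟨p, _ | _ | _ | b | q | q⟩
  · exact ⟨none, fun g' hw => by cases hw⟩
  · refine ⟨some (p, state (A.init (EUF.enu, true))), fun g' hw hpure => ?_⟩
    by_cases hl : T.labelAt p = some EUF.enu
    · cases hw <;> simp_all
    · have := hpure.2.1
      simp [provCircuit_type, provType, hl, GateType.isBoolean] at this
  · by_cases hl : T.labelAt p = some EUF.upd
    · refine ⟨some (p, box (ν (Sum.inl p))), fun g' hw hpure => ?_⟩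
      cases hw with
      | empBox _ b =>
        have := hpure.2.2
        rw [provCircuit_type, bval_box_inputs A e ν he hl] at this
        simp [provType] at this
        rw [this]
      | _ => simp_all
    · by_cases hl' : T.labelAt p = some EUF.enu
      · exact ⟨some (p, state (A.init (EUF.enu, false))),
          fun g' hw _ => by cases hw <;> simp_all⟩
      · exact ⟨some (p, state (A.init (EUF.fixLab, false))),
          fun g' hw _ => by cases hw <;> simp_all⟩
  · refine ⟨none, fun g' _ hpure => ?_⟩
    have := hpure.2.1
    simp [provCircuit_type, provType, GateType.isBoolean] at this
  · exact ⟨some (p, state (A.init (EUF.upd, b))), fun g' hw _ => by cases hw; rfl⟩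
  · rcases List.eq_nil_or_concat' p with rfl | ⟨p, b, rfl⟩
    · refine ⟨none, fun g' hw _ => ?_⟩
      rcases hw.of_state with ⟨-, rfl⟩ | ⟨p, b, r, hp, -⟩
      · rfl
      · simp at hp
    · refine ⟨some (p, pair fun c => if c = b then q else stateAt A T ν (p ++ [c]) ∅),
        fun g' hw hpure => ?_⟩
      rcases hw.of_state with ⟨hp, -⟩ | ⟨p, b, r, hpb, rfl, hp, rfl⟩
      · simp at hp
      obtain ⟨rfl, rfl⟩ : _ ∧ _ := by simpa using hpb
      obtain ⟨hp', -⟩ := T.sub_of_child hp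
      have := hpure.2.2
      simp only [provCircuit_type, provType, reduceCtorEq, false_and, false_or, true_and] at this
      obtain ⟨x, hx, hne, hempty⟩ := this
      obtain ⟨g, rfl, hg⟩ := (provCircuit_wire A T e).1 hx
      cases hg with
      | statePair _ _ c =>
      rw [sval_state A e ν hT he (by cases c <;> assumption)] at hempty
      congr
      funext d
      split_ifs with hd
      · rw [hd]
      · obtain rfl : d = c := by
          have : c ≠ b := by rintro rfl; exact hne rfl
          cases b <;> cases c <;> cases d <;> simp_all
        exact hempty.2.symm
  · exact ⟨some (p, state (A.trans (q false) (q true) (EUF.fixLab, false))),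
      fun g' hw _ => by cases hw; rfl⟩

theorem upwardsDeterministic_provCircuit
    (hT : ∀ p : List Bool, T.labelAt (p ++ [false]) ≠ none → T.labelAt p = some EUF.fixLab)
    (he : ∀ p, e (some (p, var)) = Sum.inl p) :
    upwardsDeterministic (provCircuit A T e) := by
  intro ν x x₁ x₂ h₁ h₂
  obtain ⟨g, g₁, hw₁, rfl, rfl⟩ := id h₁.1
  obtain ⟨g', g₂, hw₂, hg, rfl⟩ := id h₂.1
  obtain rfl := e.injective hg
  obtain ⟨g₀, h₀⟩ := exists_target_of_pureWire A e ν hT he g'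
  rw [h₀ g₁ hw₁ h₁, h₀ g₂ hw₂ h₂]

theorem card_gates_provCircuit_le [Nonempty Q] :
    (provCircuit A T e).gates.card ≤ 1 + 7 * T.size * Nat.card Q ^ 2 := by
  have h₁ := Set.ncard_le_ncard (provValid_subset (Q := Q) T)
    (finite_gatesOver T.finite_positions)
  have h₂ := ncard_gatesOver_le (Q := Q) T.finite_positions T.ncard_positions_le
  have h₃ := Set.ncard_image_of_injective {g : ProvGate Q | provValid T g} e.injective
  rw [Set.ncard_eq_toFinset_card _ (((finite_gatesOver T.finite_positions).subset
    (provValid_subset (Q := Q) T)).image e)] at h₃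
  exact h₃.le.trans (h₁.trans h₂)

theorem maxFanIn_provCircuit_le [Nonempty Q] :
    maxFanIn (provCircuit A T e) ≤ 1 + 7 * 3 * Nat.card Q ^ 2 := by
  refine Finset.sup_le fun x hx => ?_
  obtain ⟨g, -, rfl⟩ := (mem_provCircuit_gates A e).1 hx
  obtain ⟨p, hp⟩ := inputs_subset (A := A) (T := T) g
  have hfin : ({p, p ++ [false], p ++ [true]} : Set (List Bool)).Finite := by simp
  refine le_trans ?_ (ncard_gatesOver_le (Q := Q) hfin ?_)
  · have : {x | (provCircuit A T e).wire x (e g)} = e '' {g' | ProvWire A T g' g} := by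
      ext x
      simp [provCircuit_wire, and_comm]
    rw [fanIn, this, Set.ncard_image_of_injective _ e.injective]
    exact Set.ncard_le_ncard hp (finite_gatesOver hfin)
  · exact (Set.ncard_insert_le _ _).trans
      (Nat.succ_le_succ ((Set.ncard_insert_le _ _).trans (by simp)))

theorem depSize_provCircuit_le [Nonempty Q] :
    depSize (provCircuit A T e) ≤ 1 + 7 * T.height * Nat.card Q ^ 2 := by
  refine Finset.sup_le fun x hx => ?_
  obtain ⟨g, hv, rfl⟩ := (mem_provCircuit_gates A e).1 hx
  have hover {P : Set (List Bool)} (hP : P.Finite) (hcard : P.ncard ≤ T.height)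
      (hg : ∀ p k, Relation.ReflTransGen (ProvWire A T) g (some (p, k)) → p ∈ P) :
      (deltaSet (provCircuit A T e) (e g)).ncard ≤ 1 + 7 * T.height * Nat.card Q ^ 2 := by
    refine le_trans ?_ (ncard_gatesOver_le (Q := Q) hP hcard)
    rw [← Set.ncard_image_of_injective _ e.injective]
    refine Set.ncard_le_ncard ?_ ((finite_gatesOver hP).image e)
    intro y hy
    obtain ⟨g', rfl, hpath⟩ := exists_path_of_path A e hy
    refine ⟨g', ?_, rfl⟩
    rintro ⟨p, k⟩ rfl
    exact hg p k hpath
  rcases g with _ | ⟨p, k⟩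
  · refine hover (P := ∅) Set.finite_empty (by simp) fun p k h => ?_
    simpa using nested_of_path h (p, k) rfl
  · have hp : T.labelAt p ≠ none := provValid_subset T hv (p, k) rfl
    refine hover (P := ↑p.inits.toFinset) (Finset.finite_toSet _) ?_ fun s k h => ?_
    · refine (Set.ncard_coe_finset _).le.trans ((List.toFinset_card_le _).trans ?_)
      simpa using T.length_lt_height hp
    · simpa using nested_of_path h (s, k) rfl

end Correctness

theorem exists_gate_embedding (Q : Type) [Finite Q] :
    ∃ e : ProvGate Q ↪ List Bool ⊕ ℕ, ∀ p, e (some (p, .var)) = Sum.inl p := by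
  obtain ⟨f, hf⟩ := Countable.exists_injective_nat (ProvGate Q)
  refine ⟨⟨fun
    | some (p, .var) => .inl p
    | g => .inr (f g), ?_⟩, fun p => rfl⟩
  rintro (_ | ⟨p, _ | _ | _ | _ | _ | _⟩) (_ | ⟨p', _ | _ | _ | _ | _ | _⟩) h <;>
    simp_all [hf.eq_iff]

/-- there is a constant `c` such that for every bottom-up deterministic tree
automaton `A'` on Σ̄ = {enu, upd, fix} × {0,1} (with finitely many states) and every Σ-tree
`T` whose internal nodes are all labeled fix, there is a hybrid circuit `C` that is a
provenance circuit of `A'` on `T`, is a d-DNNF, is upwards-deterministic, has at most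
`c * |T| * |A'|` gates, maximal fan-in at most `c * |A'|`, and dependency size at most
`c * |A'| * h(T)`. -/
theorem provenance_circuit_exists :
    ∃ c : ℕ, 0 < c ∧ ∀ (Q : Type), Finite Q → ∀ (A' : BDTA (EUF × Bool) Q) (T : BTree EUF),
      (∀ p : List Bool, T.labelAt (p ++ [false]) ≠ none →
        T.labelAt p = some EUF.fixLab) →
      ∃ C : HybridCircuit (List Bool ⊕ ℕ),
        isProvenanceCircuit A' T C ∧
        isDDNNF C ∧
        upwardsDeterministic C ∧
        C.gates.card ≤ c * T.size * A'.size ∧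
        maxFanIn C ≤ c * A'.size ∧
        depSize C ≤ c * A'.size * T.height := by
  refine ⟨4, by norm_num, fun Q _ A T hT => ?_⟩
  have : Nonempty Q := ⟨A.init (EUF.enu, false)⟩
  obtain ⟨e, he⟩ := exists_gate_embedding Q
  have hQ : 1 ≤ Nat.card Q ^ 2 := Nat.one_le_pow _ _ Nat.card_pos
  have hh : 1 ≤ T.height := T.length_lt_height T.labelAt_nil_ne_none
  have hs := T.one_le_size
  refine ⟨provCircuit A T e, isProvenanceCircuit_provCircuit A e hT he,
    ⟨decomposable_provCircuit A e, deterministic_provCircuit A e hT he⟩,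
    upwardsDeterministic_provCircuit A e hT he,
    (card_gates_provCircuit_le A e).trans ?_, (maxFanIn_provCircuit_le A e).trans ?_,
    (depSize_provCircuit_le A e).trans ?_⟩ <;> rw [BDTA.size]
  · nlinarith [Nat.mul_le_mul hs hQ]
  · linarith
  · nlinarith [Nat.mul_le_mul hh hQ]

end MSOEnum
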